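/- arXiv:1907.12587 — 7 statements merged into one kernel-verified Lean document; each statement's English description precedes it below -/
import Mathlib

section
/- Let 1 → H → E →(π)→ G → 1 be an extension of groups and Z the center of H, endowed with the G-action induced by conjugation in E. The map sending a crossed homomorphism φ : G → Z (i.e. φ(gg') = φ(g)·(g·φ(g')) for all g, g' ∈ G) to the map E → E, x ↦ φ(π(x))·x, is a group isomorphism from the group Z¹(G,Z) of crossed homomorphisms (under pointwise multiplication) onto the group of automorphisms of the extension E (automorphisms of E restricting to the identity on H and inducing the identity on G) under composition. -/
namespace PaperExt

/-- `1 → H → E → G → 1` is a short exact sequence: `ι` is injective, `π` is surjective,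
and the image of `ι` is the kernel of `π`. -/
structure IsExtension {H E G : Type*} [Group H] [Group E] [Group G]
    (ι : H →* E) (π : E →* G) : Prop where
  inj : Function.Injective ι
  surj : Function.Surjective π
  range_eq_ker : ι.range = π.ker

theorem IsExtension.pi_iota {H E G : Type*} [Group H] [Group E] [Group G]
    {ι : H →* E} {π : E →* G} (h : IsExtension ι π) (x : H) : π (ι x) = 1 := by
  have hx : ι x ∈ π.ker := h.range_eq_ker ▸ ⟨x, rfl⟩
  exact hx

theorem IsExtension.centerMap_le_ker {H E G : Type*} [Group H] [Group E] [Group G]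
    {ι : H →* E} {π : E →* G} (h : IsExtension ι π) :
    (Subgroup.center H).map ι ≤ π.ker := by
  rintro _ ⟨z, _, rfl⟩
  exact h.pi_iota z

/-- Equivalence of extensions of `G`: an isomorphism restricting to the identity on the
kernel group and inducing the identity on `G`. -/
def ExtEquiv {H E E' G : Type*} [Group H] [Group E] [Group E'] [Group G]
    (ι : H →* E) (π : E →* G) (ι' : H →* E') (π' : E' →* G) : Prop :=
  ∃ f : E ≃* E', (∀ x : H, f (ι x) = ι' x) ∧ ∀ x : E, π' (f x) = π x

/-- The fiberProd product of two homomorphisms, as a subgroup of the product. -/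
def fiberProd {E₁ E₂ G : Type*} [Group E₁] [Group E₂] [Group G]
    (π₁ : E₁ →* G) (π₂ : E₂ →* G) : Subgroup (E₁ × E₂) where
  carrier := {p | π₁ p.1 = π₂ p.2}
  one_mem' := by simp
  mul_mem' := by
    intro a b ha hb
    simp only [Set.mem_setOf_eq, Prod.fst_mul, Prod.snd_mul, map_mul] at *
    rw [ha, hb]
  inv_mem' := by
    intro a ha
    simp only [Set.mem_setOf_eq, Prod.fst_inv, Prod.snd_inv, map_inv] at *
    rw [ha]

theorem mem_fiberProd {E₁ E₂ G : Type*} [Group E₁] [Group E₂] [Group G]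
    {π₁ : E₁ →* G} {π₂ : E₂ →* G} {p : E₁ × E₂} :
    p ∈ fiberProd π₁ π₂ ↔ π₁ p.1 = π₂ p.2 := Iff.rfl

/-- The extension `(ι', π')` of `G` by the center of `H` induces the same `G`-action on the
center of `H` as the extension `(ι, π)` of `G` by `H` does by conjugation. -/
def SameActionOnZ {H E E' G : Type*} [Group H] [Group E] [Group E'] [Group G]
    (ι : H →* E) (π : E →* G) (ι' : Subgroup.center H →* E') (π' : E' →* G) : Prop :=
  ∀ (x : E) (x' : E'), π x = π' x' → ∀ z z' : Subgroup.center H,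
    (x * ι z * x⁻¹ = ι z' ↔ x' * ι' z * x'⁻¹ = ι' z')

/-- Two extensions of `G` by `H` induce the same outer action: there is an equivalence
between the quotients modulo the (embedded) center of `H`, as extensions of `G` by
`H/Z(H)`, which is compatible with the conjugation actions on `H`. -/
def SameOuterAction {H E₁ E₂ G : Type*} [Group H] [Group E₁] [Group E₂] [Group G]
    (ι₁ : H →* E₁) (π₁ : E₁ →* G) (ι₂ : H →* E₂) (π₂ : E₂ →* G)
    [((Subgroup.center H).map ι₁).Normal] [((Subgroup.center H).map ι₂).Normal] : Prop :=
  ∃ φ : (E₁ ⧸ (Subgroup.center H).map ι₁) ≃* (E₂ ⧸ (Subgroup.center H).map ι₂),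
    (∀ x : H, φ (QuotientGroup.mk (ι₁ x)) = QuotientGroup.mk (ι₂ x)) ∧
    (∀ (x : E₁) (y : E₂), φ (QuotientGroup.mk x) = QuotientGroup.mk y → π₂ y = π₁ x) ∧
    (∀ (x : E₁) (y : E₂), φ (QuotientGroup.mk x) = QuotientGroup.mk y →
      ∀ a b : H, (x * ι₁ a * x⁻¹ = ι₁ b ↔ y * ι₂ a * y⁻¹ = ι₂ b))

/-- The "anti-diagonal" subgroup `{(κ₁ a⁻¹, κ₂ a)}`, i.e. the image of the kernel of the
multiplication map under a pair of embeddings of an abelian group. -/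
def antiKer {A K₁ K₂ : Type*} [CommGroup A] [Group K₁] [Group K₂]
    (κ₁ : A →* K₁) (κ₂ : A →* K₂) : Subgroup (K₁ × K₂) :=
  ((κ₁.comp invMonoidHom).prod κ₂).range

/-- The kernel of the multiplication map, viewed inside the fiberProd product. -/
def pushKer {A K₁ K₂ G : Type*} [CommGroup A] [Group K₁] [Group K₂] [Group G]
    (π₁ : K₁ →* G) (π₂ : K₂ →* G) (κ₁ : A →* K₁) (κ₂ : A →* K₂) :
    Subgroup ↥(fiberProd π₁ π₂) :=
  (antiKer κ₁ κ₂).comap (fiberProd π₁ π₂).subtype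

/-- The kernel inclusion of the pushforward of the fiberProd product `K₁ ×_G K₂` along the
multiplication map. -/
def pushInl {A K₁ K₂ G H : Type*} [CommGroup A] [Group K₁] [Group K₂] [Group G] [Group H]
    (π₁ : K₁ →* G) (π₂ : K₂ →* G) (κ₁ : A →* K₁) (κ₂ : A →* K₂)
    (ι₁ : H →* K₁) (hι : ∀ x, π₁ (ι₁ x) = 1)
    [(pushKer π₁ π₂ κ₁ κ₂).Normal] :
    H →* ↥(fiberProd π₁ π₂) ⧸ pushKer π₁ π₂ κ₁ κ₂ :=
  (QuotientGroup.mk' _).comp (MonoidHom.codRestrict (ι₁.prod 1) (fiberProd π₁ π₂)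
    (fun x => by
      show π₁ (ι₁ x) = π₂ 1
      rw [map_one]; exact hι x))

/-- The projection of the pushforward of the fiberProd product `K₁ ×_G K₂` along the
multiplication map. -/
def pushRight {A K₁ K₂ G : Type*} [CommGroup A] [Group K₁] [Group K₂] [Group G]
    (π₁ : K₁ →* G) (π₂ : K₂ →* G) (κ₁ : A →* K₁) (κ₂ : A →* K₂)
    (hκ : ∀ a, π₁ (κ₁ a) = 1)
    [(pushKer π₁ π₂ κ₁ κ₂).Normal] :
    (↥(fiberProd π₁ π₂) ⧸ pushKer π₁ π₂ κ₁ κ₂) →* G :=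
  QuotientGroup.lift _ (π₁.comp ((MonoidHom.fst K₁ K₂).comp (fiberProd π₁ π₂).subtype))
    (by
      rintro x ⟨a, ha⟩
      have h1 : π₁ ((fiberProd π₁ π₂).subtype x).1 = 1 := by
        rw [← ha]; exact hκ a⁻¹
      exact MonoidHom.mem_ker.mpr h1)

theorem pushRight_pushInl {A K₁ K₂ G H : Type*} [CommGroup A] [Group K₁] [Group K₂]
    [Group G] [Group H]
    (π₁ : K₁ →* G) (π₂ : K₂ →* G) (κ₁ : A →* K₁) (κ₂ : A →* K₂)
    (hκ : ∀ a, π₁ (κ₁ a) = 1) (ι₁ : H →* K₁) (hι : ∀ x, π₁ (ι₁ x) = 1)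
    [(pushKer π₁ π₂ κ₁ κ₂).Normal] (x : H) :
    pushRight π₁ π₂ κ₁ κ₂ hκ (pushInl π₁ π₂ κ₁ κ₂ ι₁ hι x) = 1 := by
  show π₁ (ι₁ x) = 1
  exact hι x

/-- The subgroup of a given normal-coset-compatible subgroup of `E₁ × E₂`, namely
the preimage of quotient-equality: `{(x, y) | φ (x Z) = y Z}`. -/
def phiFiber {E₁ E₂ : Type*} [Group E₁] [Group E₂]
    {N₁ : Subgroup E₁} {N₂ : Subgroup E₂} [N₁.Normal] [N₂.Normal]
    (φ : (E₁ ⧸ N₁) ≃* (E₂ ⧸ N₂)) : Subgroup (E₁ × E₂) where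
  carrier := {p | φ (QuotientGroup.mk p.1) = QuotientGroup.mk p.2}
  one_mem' := by simp
  mul_mem' := by
    intro a b ha hb
    simp only [Set.mem_setOf_eq, Prod.fst_mul, Prod.snd_mul, QuotientGroup.mk_mul,
      map_mul] at *
    rw [ha, hb]
  inv_mem' := by
    intro a ha
    simp only [Set.mem_setOf_eq, Prod.fst_inv, Prod.snd_inv, QuotientGroup.mk_inv,
      map_inv] at *
    rw [ha]

theorem mem_phiFiber {E₁ E₂ : Type*} [Group E₁] [Group E₂]
    {N₁ : Subgroup E₁} {N₂ : Subgroup E₂} [N₁.Normal] [N₂.Normal]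
    {φ : (E₁ ⧸ N₁) ≃* (E₂ ⧸ N₂)} {p : E₁ × E₂} :
    p ∈ phiFiber φ ↔ φ (QuotientGroup.mk p.1) = QuotientGroup.mk p.2 := Iff.rfl

theorem mem_phiFiber_one {H E₁ E₂ : Type*} [Group H] [Group E₁] [Group E₂]
    {N₁ : Subgroup E₁} [N₁.Normal] (ι₂ : H →* E₂)
    [((Subgroup.center H).map ι₂).Normal]
    (φ : (E₁ ⧸ N₁) ≃* (E₂ ⧸ (Subgroup.center H).map ι₂)) (z : Subgroup.center H) :
    ((1 : E₁), ι₂ ↑z) ∈ phiFiber φ := by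
  have h2 : (QuotientGroup.mk (ι₂ ↑z) : E₂ ⧸ (Subgroup.center H).map ι₂) = 1 :=
    (QuotientGroup.eq_one_iff _).mpr (Subgroup.mem_map.mpr ⟨↑z, z.2, rfl⟩)
  show φ (QuotientGroup.mk (1 : E₁)) = QuotientGroup.mk (ι₂ ↑z)
  rw [h2, QuotientGroup.mk_one, map_one]

/-- The diagonal copy of `H`, viewed inside a subgroup `S` of `E₁ × E₂`. -/
def diagIn {H E₁ E₂ : Type*} [Group H] [Group E₁] [Group E₂]
    (ι₁ : H →* E₁) (ι₂ : H →* E₂) (S : Subgroup (E₁ × E₂)) : Subgroup ↥S :=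
  ((ι₁.prod ι₂).range).comap S.subtype

/-- The embedding of the center of `H` into the quotient of `S ≤ E₁ × E₂` by the diagonal
copy of `H`, via `z ↦ (1, z)·Δ(H)`. -/
def diagQuotIota {H E₁ E₂ : Type*} [Group H] [Group E₁] [Group E₂]
    (ι₁ : H →* E₁) (ι₂ : H →* E₂) (S : Subgroup (E₁ × E₂))
    (hmem : ∀ z : Subgroup.center H, ((1 : E₁), ι₂ ↑z) ∈ S)
    [(diagIn ι₁ ι₂ S).Normal] :
    Subgroup.center H →* ↥S ⧸ diagIn ι₁ ι₂ S :=
  (QuotientGroup.mk' _).comp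
    (MonoidHom.codRestrict ((1 : Subgroup.center H →* E₁).prod
      (ι₂.comp (Subgroup.center H).subtype)) S (fun z => hmem z))

/-- The projection to `G` of the quotient of `S ≤ E₁ × E₂` by the diagonal copy of `H`. -/
def diagQuotPi {H E₁ E₂ G : Type*} [Group H] [Group E₁] [Group E₂] [Group G]
    (ι₁ : H →* E₁) (ι₂ : H →* E₂) (S : Subgroup (E₁ × E₂)) (π₁ : E₁ →* G)
    (hk : ∀ x : H, π₁ (ι₁ x) = 1) [(diagIn ι₁ ι₂ S).Normal] :
    (↥S ⧸ diagIn ι₁ ι₂ S) →* G :=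
  QuotientGroup.lift _ (π₁.comp ((MonoidHom.fst E₁ E₂).comp S.subtype))
    (by
      rintro x ⟨a, ha⟩
      have h1 : π₁ (S.subtype x).1 = 1 := by
        rw [← ha]; exact hk a
      exact MonoidHom.mem_ker.mpr h1)

/-- The projection `E/Z → G` induced by `π : E → G`. -/
def modPi {H E G : Type*} [Group H] [Group E] [Group G] (ι : H →* E) (π : E →* G)
    (hk : (Subgroup.center H).map ι ≤ π.ker)
    [((Subgroup.center H).map ι).Normal] :
    (E ⧸ (Subgroup.center H).map ι) →* G :=
  QuotientGroup.lift _ π hk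

theorem one_iota_mem_fiberProdZ {H E : Type*} [Group H] [Group E] (ι : H →* E)
    [((Subgroup.center H).map ι).Normal] (z : Subgroup.center H) :
    ((1 : E), ι ↑z) ∈ fiberProd (QuotientGroup.mk' ((Subgroup.center H).map ι))
      (QuotientGroup.mk' ((Subgroup.center H).map ι)) := by
  have h2 : (QuotientGroup.mk (ι ↑z) : E ⧸ (Subgroup.center H).map ι) = 1 :=
    (QuotientGroup.eq_one_iff _).mpr (Subgroup.mem_map.mpr ⟨↑z, z.2, rfl⟩)
  show QuotientGroup.mk (1 : E) = QuotientGroup.mk (ι ↑z)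
  rw [h2, QuotientGroup.mk_one]

/-- The embedding of the center of `H` into the pullback `E_s` of `E → E/Z` along a
section `s : G → E/Z`, via `z ↦ (z, 1)`. -/
def pullIota {H E G : Type*} [Group H] [Group E] [Group G] (ι : H →* E)
    [((Subgroup.center H).map ι).Normal]
    (s : G →* E ⧸ (Subgroup.center H).map ι) :
    Subgroup.center H →* ↥(fiberProd (QuotientGroup.mk' ((Subgroup.center H).map ι)) s) :=
  MonoidHom.codRestrict ((ι.comp (Subgroup.center H).subtype).prod 1) _
    (fun z => by
      show QuotientGroup.mk (ι ↑z) = s 1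
      rw [map_one]
      exact (QuotientGroup.eq_one_iff _).mpr (Subgroup.mem_map.mpr ⟨↑z, z.2, rfl⟩))

/-- The projection of the pullback `E_s` to `G`. -/
def pullPi {H E G : Type*} [Group H] [Group E] [Group G] (ι : H →* E)
    [((Subgroup.center H).map ι).Normal]
    (s : G →* E ⧸ (Subgroup.center H).map ι) :
    ↥(fiberProd (QuotientGroup.mk' ((Subgroup.center H).map ι)) s) →* G :=
  (MonoidHom.snd E G).comp (fiberProd (QuotientGroup.mk' ((Subgroup.center H).map ι)) s).subtype

/-- Inner automorphisms form a normal subgroup of the automorphism group. -/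
instance innNormal (H : Type*) [Group H] : ((MulAut.conj (G := H)).range).Normal := by
  constructor
  rintro _ ⟨h, rfl⟩ σ
  refine ⟨σ h, ?_⟩
  ext x
  simp only [MulAut.conj_apply, MulAut.mul_apply, map_mul, map_inv]
  rw [MulAut.apply_inv_self]

/-- The canonical homomorphism from `E` to the fiberProd product `Aut(H) ×_{Out(H)} G`. -/
def conjFiberHom {H E G : Type*} [Group H] [Group E] [Group G]
    (c : E →* MulAut H) (π : E →* G)
    (κ : G →* (MulAut H ⧸ (MulAut.conj (G := H)).range))
    (hκ : ∀ x : E, κ (π x) = QuotientGroup.mk (c x)) :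
    E →* ↥(fiberProd (QuotientGroup.mk' (MulAut.conj (G := H)).range) κ) :=
  MonoidHom.codRestrict (c.prod π) _ (fun x => (hκ x).symm)

end PaperExt


open PaperExt

/-- A map `φ : G → Z(H)` is a crossed homomorphism (Hochschild 1-cocycle) for the
`G`-action on `Z(H)` induced by conjugation in the extension `E`:
`φ(g g') = φ(g) · (g · φ(g'))`, where the action is computed via arbitrary lifts. -/
def IsCrossed {H E G : Type*} [Group H] [Group E] [Group G]
    (ι : H →* E) (π : E →* G) (φ : G → Subgroup.center H) : Prop :=
  ∀ x y : E, (ι ↑(φ (π x * π y)) : E) = ι ↑(φ (π x)) * (x * ι ↑(φ (π y)) * x⁻¹)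

/-- `f : E → E` is an automorphism of the extension `(ι, π)`: a group automorphism of `E`
restricting to the identity on (the image of) `H` and inducing the identity on `G`. -/
def IsExtAut {H E G : Type*} [Group H] [Group E] [Group G]
    (ι : H →* E) (π : E →* G) (f : E → E) : Prop :=
  Function.Bijective f ∧ (∀ a b : E, f (a * b) = f a * f b) ∧
    (∀ x : H, f (ι x) = ι x) ∧ (∀ x : E, π (f x) = π x)

namespace PaperExt

variable {H E G : Type*} [Group H] [Group E] [Group G] {ι : H →* E} {π : E →* G}

theorem IsExtension.exists_eq_mul (h : IsExtension ι π) {x y : E} (hxy : π x = π y) :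
    ∃ n : H, x = ι n * y := by
  have hk : x * y⁻¹ ∈ π.ker := by simp [MonoidHom.mem_ker, hxy]
  rw [← h.range_eq_ker] at hk
  obtain ⟨n, hn⟩ := hk
  exact ⟨n, by simp [hn]⟩

theorem map_one_of_isCrossed (h : IsExtension ι π) {φ : G → Subgroup.center H}
    (hφ : IsCrossed ι π φ) : φ 1 = 1 := by
  have h1 := hφ 1 1
  simp only [map_one, mul_one, one_mul, inv_one, left_eq_mul] at h1
  exact Subtype.ext (h.inj (by simpa using h1))

theorem isExtAut_of_isCrossed (h : IsExtension ι π) {φ : G → Subgroup.center H}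
    (hφ : IsCrossed ι π φ) : IsExtAut ι π (fun x => ι ↑(φ (π x)) * x) := by
  have hπ (x : E) : π (ι ↑(φ (π x)) * x) = π x := by simp [h.pi_iota]
  refine ⟨⟨fun x y hxy => ?_, fun y => ?_⟩, fun a b => ?_, fun x => ?_, hπ⟩
  · dsimp only at hxy
    have hxy' : π x = π y := by rw [← hπ x, hxy, hπ y]
    rw [hxy'] at hxy
    exact mul_left_cancel hxy
  · refine ⟨(ι ↑(φ (π y)))⁻¹ * y, ?_⟩
    simp [h.pi_iota]
  · simp only [map_mul, hφ a b]
    group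
  · simp [h.pi_iota, map_one_of_isCrossed h hφ]

/-- The displacement `f x * x⁻¹` of an automorphism of an extension lies in the center of the
kernel. -/
theorem _root_.IsExtAut.exists_center (h : IsExtension ι π) {f : E → E} (hf : IsExtAut ι π f) (x : E) :
    ∃ z : Subgroup.center H, f x = ι ↑z * x := by
  obtain ⟨_, hmul, hι, hπ⟩ := hf
  obtain ⟨n, hn⟩ := h.exists_eq_mul (hπ x)
  refine ⟨⟨n, Subgroup.mem_center_iff.mpr fun a => h.inj ?_⟩, hn⟩
  have hk : x⁻¹ * ι a * x ∈ π.ker := by simp [MonoidHom.mem_ker, h.pi_iota]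
  rw [← h.range_eq_ker] at hk
  obtain ⟨b, hb⟩ := hk
  have hab : ι a * x = x * ι b := by rw [hb]; group
  have key : ι a * (ι n * x) = ι n * (ι a * x) := by
    calc ι a * (ι n * x) = f (ι a * x) := by rw [hmul, hι, hn]
      _ = ι n * x * ι b := by rw [hab, hmul, hι, hn]
      _ = ι n * (ι a * x) := by rw [hab, mul_assoc]
  rw [map_mul, map_mul]
  exact mul_right_cancel (b := x) (by simpa only [mul_assoc] using key)

theorem _root_.IsExtAut.exists_map (h : IsExtension ι π) {f : E → E} (hf : IsExtAut ι π f) :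
    ∃ φ : G → Subgroup.center H, ∀ x : E, f x = ι ↑(φ (π x)) * x := by
  choose z hz using hf.exists_center h
  refine ⟨fun g => z (Function.surjInv h.surj g), fun x => ?_⟩
  obtain ⟨n, hn⟩ := h.exists_eq_mul (Function.surjInv_eq h.surj (π x)).symm
  set y := Function.surjInv h.surj (π x)
  have hc : n * ↑(z y) = ↑(z y) * n := Subgroup.mem_center_iff.mp (z y).2 n
  calc f x = ι (n * ↑(z y)) * y := by rw [hn, hf.2.1, hf.2.2.1, hz y, map_mul, mul_assoc]
    _ = ι ↑(z y) * x := by rw [hc, hn, map_mul, mul_assoc]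

theorem isCrossed_of_map_mul {f : E → E} (hmul : ∀ a b, f (a * b) = f a * f b)
    {φ : G → Subgroup.center H} (hφ : ∀ x : E, f x = ι ↑(φ (π x)) * x) : IsCrossed ι π φ := by
  intro x y
  have hxy := hmul x y
  rw [hφ, hφ x, hφ y, map_mul] at hxy
  rw [eq_mul_inv_of_mul_eq hxy]
  group

theorem eq_of_forall_mul_eq (h : IsExtension ι π) {φ ψ : G → Subgroup.center H}
    (hφψ : ∀ x : E, ι ↑(φ (π x)) * x = ι ↑(ψ (π x)) * x) : φ = ψ := by
  funext g
  obtain ⟨x, rfl⟩ := h.surj g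
  exact Subtype.ext (h.inj (mul_right_cancel (hφψ x)))

end PaperExt

/-- the map `φ ↦ (x ↦ φ(π x) · x)` is a group isomorphism from the group of
crossed homomorphisms `Z¹(G, Z(H))` (under pointwise multiplication) onto the group of
automorphisms of the extension `E` (under composition): it sends crossed homomorphisms to
automorphisms of the extension, is multiplicative, and every automorphism of the extension
comes from a unique crossed homomorphism. -/
theorem crossed_homs_iso_extension_automorphisms
    {H E G : Type*} [Group H] [Group E] [Group G]
    (ι : H →* E) (π : E →* G) (h : IsExtension ι π) :
    (∀ φ : G → Subgroup.center H, IsCrossed ι π φ →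
      IsExtAut ι π (fun x => ι ↑(φ (π x)) * x)) ∧
    (∀ φ ψ : G → Subgroup.center H, IsCrossed ι π φ → IsCrossed ι π ψ → ∀ x : E,
      ι ↑((φ * ψ) (π x)) * x = ι ↑(φ (π (ι ↑(ψ (π x)) * x))) * (ι ↑(ψ (π x)) * x)) ∧
    (∀ f : E → E, IsExtAut ι π f →
      ∃! φ : G → Subgroup.center H, IsCrossed ι π φ ∧ ∀ x : E, f x = ι ↑(φ (π x)) * x) := by
  refine ⟨fun φ hφ => isExtAut_of_isCrossed h hφ, fun φ ψ _ _ x => ?_, fun f hf => ?_⟩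
  · simp [h.pi_iota, mul_assoc]
  · obtain ⟨φ, hφ⟩ := hf.exists_map h
    exact ⟨φ, ⟨isCrossed_of_map_mul hf.2.1 hφ, hφ⟩, fun ψ hψ =>
      eq_of_forall_mul_eq h fun x => (hψ.2 x).symm.trans (hφ x)⟩
end

section
/- Let G, H be groups, Z the center of H, let E₁, E₂ be extensions of G by H, and let φ : E₁/Z → E₂/Z be an equivalence of extensions of G by H/Z. Set E := {(x,y) ∈ E₁ × E₂ : φ(xZ) = yZ}. Then the diagonal subgroup Δ(H) = {(h,h) : h ∈ H} is normal in E if and only if φ is compatible with the conjugation actions on H, i.e. whenever φ(xZ) = yZ (x ∈ E₁, y ∈ E₂), conjugation by x and conjugation by y agree on H. -/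
open PaperExt

/-- given two extensions of `G` by `H` and an equivalence
`φ : E₁/Z → E₂/Z` of extensions of `G` by `H/Z` (`Z` the center of `H`), the diagonal
`Δ(H)` is normal in `E = {(x, y) | φ(xZ) = yZ}` if and only if `φ` is compatible with the
conjugation actions on `H`. -/
theorem diagonal_normal_iff_compatible_with_conjugation
    {G H E₁ E₂ : Type*} [Group G] [Group H] [Group E₁] [Group E₂]
    (ι₁ : H →* E₁) (π₁ : E₁ →* G) (ι₂ : H →* E₂) (π₂ : E₂ →* G)
    (h₁ : IsExtension ι₁ π₁) (h₂ : IsExtension ι₂ π₂)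
    [((Subgroup.center H).map ι₁).Normal] [((Subgroup.center H).map ι₂).Normal]
    (φ : (E₁ ⧸ (Subgroup.center H).map ι₁) ≃* (E₂ ⧸ (Subgroup.center H).map ι₂))
    (hφι : ∀ x : H, φ (QuotientGroup.mk (ι₁ x)) = QuotientGroup.mk (ι₂ x))
    (hφπ : ∀ (x : E₁) (y : E₂), φ (QuotientGroup.mk x) = QuotientGroup.mk y → π₂ y = π₁ x) :
    (diagIn ι₁ ι₂ (phiFiber φ)).Normal ↔
      ∀ (x : E₁) (y : E₂), φ (QuotientGroup.mk x) = QuotientGroup.mk y →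
        ∀ a b : H, (x * ι₁ a * x⁻¹ = ι₁ b ↔ y * ι₂ a * y⁻¹ = ι₂ b) := by
  constructor
  · intro hN x y hxy a b
    obtain ⟨c, hc⟩ := hN.conj_mem ⟨(ι₁ a, ι₂ a), hφι a⟩ ⟨a, rfl⟩ ⟨(x, y), hxy⟩
    have hc₁ : ι₁ c = x * ι₁ a * x⁻¹ := congrArg Prod.fst hc
    have hc₂ : ι₂ c = y * ι₂ a * y⁻¹ := congrArg Prod.snd hc
    rw [← hc₁, ← hc₂, h₁.inj.eq_iff, h₂.inj.eq_iff]
  · intro hconj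
    refine ⟨?_⟩
    rintro ⟨_, _⟩ ⟨a, rfl⟩ ⟨⟨x, y⟩, hxy⟩
    have hker : x * ι₁ a * x⁻¹ ∈ π₁.ker := by
      simp [MonoidHom.mem_ker, h₁.pi_iota]
    rw [← h₁.range_eq_ker] at hker
    obtain ⟨b, hb⟩ := hker
    exact ⟨b, Prod.ext hb ((hconj x y hxy a b).mp hb.symm).symm⟩
end

section
/- Let 1 → H → E → G → 1 be an extension of groups, Z the center of H, c : E → Aut(H) the conjugation homomorphism, p : Aut(H) → Out(H) := Aut(H)/Inn(H) the projection, and κ : G → Out(H) the induced outer action (the composite p∘c factors through E → G since c(H) = Inn(H)). Then the homomorphism E → Aut(H) ×_{Out(H)} G, e ↦ (c(e), ē), is surjective with kernel Z; consequently it induces an isomorphism E/Z ≅ Aut(H) ×_{Out(H)} G, where the fiber product is taken over p and κ. -/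
open PaperExt

/-- In an extension of `G` by `H`, the conjugation action of `H ≤ E` on `H` is by inner
automorphisms. -/
theorem PaperExt.IsExtension.conjAction_iota {H E G : Type*} [Group H] [Group E] [Group G]
    {ι : H →* E} {π : E →* G} (h : IsExtension ι π) {c : E →* MulAut H}
    (hc : ∀ (x : E) (a : H), ι (c x a) = x * ι a * x⁻¹) (b : H) :
    c (ι b) = MulAut.conj b := by
  ext a
  apply h.inj
  rw [hc, MulAut.conj_apply, map_mul, map_mul, map_inv]

theorem MulAut.ker_conj_eq_center (H : Type*) [Group H] :
    (MulAut.conj (G := H)).ker = Subgroup.center H := by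
  ext a
  simp only [MonoidHom.mem_ker, Subgroup.mem_center_iff, MulEquiv.ext_iff, MulAut.conj_apply,
    MulAut.one_apply, mul_inv_eq_iff_eq_mul]
  exact forall_congr' fun _ => eq_comm

theorem PaperExt.IsExtension.conjFiberHom_surjective {H E G : Type*} [Group H] [Group E] [Group G]
    {ι : H →* E} {π : E →* G} (h : IsExtension ι π) {c : E →* MulAut H}
    (hc : ∀ (x : E) (a : H), ι (c x a) = x * ι a * x⁻¹)
    {κ : G →* (MulAut H ⧸ (MulAut.conj (G := H)).range)}
    (hκ : ∀ x : E, κ (π x) = QuotientGroup.mk (c x)) :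
    Function.Surjective (conjFiberHom c π κ hκ) := by
  rintro ⟨⟨σ, g⟩, hσ⟩
  obtain ⟨x, rfl⟩ := h.surj g
  obtain ⟨b, hb⟩ := QuotientGroup.eq.mp ((mem_fiberProd.mp hσ).trans (hκ x)).symm
  refine ⟨x * ι b, Subtype.ext (Prod.ext ?_ ?_)⟩
  · change c (x * ι b) = σ
    rw [map_mul, h.conjAction_iota hc, hb, mul_inv_cancel_left]
  · change π (x * ι b) = π x
    rw [map_mul, h.pi_iota, mul_one]

theorem PaperExt.IsExtension.ker_conjFiberHom {H E G : Type*} [Group H] [Group E] [Group G]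
    {ι : H →* E} {π : E →* G} (h : IsExtension ι π) {c : E →* MulAut H}
    (hc : ∀ (x : E) (a : H), ι (c x a) = x * ι a * x⁻¹)
    {κ : G →* (MulAut H ⧸ (MulAut.conj (G := H)).range)}
    (hκ : ∀ x : E, κ (π x) = QuotientGroup.mk (c x)) :
    (conjFiberHom c π κ hκ).ker = (Subgroup.center H).map ι := by
  have hker : (conjFiberHom c π κ hκ).ker = c.ker ⊓ π.ker :=
    (MonoidHom.ker_codRestrict _ _ _).trans (MonoidHom.ker_prod c π)
  have hcomp : c.comp ι = MulAut.conj := MonoidHom.ext (h.conjAction_iota hc)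
  rw [hker, ← h.range_eq_ker, inf_comm, ← Subgroup.map_comap_eq, MonoidHom.comap_ker, hcomp,
    MulAut.ker_conj_eq_center]

/-- for an extension `1 → H → E → G → 1` with conjugation homomorphism
`c : E → Aut(H)` and induced outer action `κ : G → Out(H)`, the homomorphism
`e ↦ (c e, π e)` from `E` to the fiber product `Aut(H) ×_{Out(H)} G` is surjective with
kernel `Z` (the image of the center of `H`); consequently it induces an isomorphism
`E/Z ≅ Aut(H) ×_{Out(H)} G`. -/
theorem conj_prod_proj_surjective_ker_center
    {G H E : Type*} [Group G] [Group H] [Group E]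
    (ι : H →* E) (π : E →* G) (h : IsExtension ι π)
    (c : E →* MulAut H) (hc : ∀ (x : E) (a : H), ι (c x a) = x * ι a * x⁻¹)
    (κ : G →* (MulAut H ⧸ (MulAut.conj (G := H)).range))
    (hκ : ∀ x : E, κ (π x) = QuotientGroup.mk (c x))
    [((Subgroup.center H).map ι).Normal] :
    Function.Surjective (conjFiberHom c π κ hκ) ∧
    (conjFiberHom c π κ hκ).ker = (Subgroup.center H).map ι ∧
    ∃ f : (E ⧸ (Subgroup.center H).map ι) ≃*
        ↥(fiberProd (QuotientGroup.mk' (MulAut.conj (G := H)).range) κ),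
      ∀ x : E, f (QuotientGroup.mk x) = conjFiberHom c π κ hκ x := by
  have hsurj := h.conjFiberHom_surjective hc hκ
  have hker := h.ker_conjFiberHom hc hκ
  exact ⟨hsurj, hker, (QuotientGroup.quotientMulEquivOfEq hker.symm).trans
    (QuotientGroup.quotientKerEquivOfSurjective _ hsurj), fun _ => rfl⟩
end

section
/- Let G, H be groups, Z the center of H, and let E₁, E₂ be extensions of G by H with induced outer actions κ₁, κ₂ : G → Out(H) (obtained from conjugation homomorphisms cᵢ : Eᵢ → Aut(H) by passing to Out(H) = Aut(H)/Inn(H) and factoring through G). Then κ₁ = κ₂ if and only if E₁ and E₂ induce the same outer action in the sense that there exists an equivalence φ : E₁/Z → E₂/Z of extensions of G by H/Z compatible with the conjugation actions on H (i.e. whenever φ(xZ) = yZ, conjugation by x and by y agree on H). -/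
open PaperExt

/-- Two homomorphisms to a common group with the same range induce an isomorphism between the
quotients by their kernels, which matches elements having the same image. -/
theorem exists_quotientMulEquiv_of_range_eq {E₁ E₂ P : Type*} [Group E₁] [Group E₂] [Group P]
    {N₁ : Subgroup E₁} {N₂ : Subgroup E₂} [N₁.Normal] [N₂.Normal] (f₁ : E₁ →* P) (f₂ : E₂ →* P)
    (hN₁ : f₁.ker = N₁) (hN₂ : f₂.ker = N₂) (hf : f₁.range = f₂.range) :
    ∃ φ : (E₁ ⧸ N₁) ≃* (E₂ ⧸ N₂), ∀ (x : E₁) (y : E₂),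
      φ (QuotientGroup.mk x) = QuotientGroup.mk y ↔ f₁ x = f₂ y := by
  subst hN₁ hN₂
  let e₁ := QuotientGroup.quotientKerEquivRange f₁
  let e₂ := QuotientGroup.quotientKerEquivRange f₂
  refine ⟨(e₁.trans (MulEquiv.subgroupCongr hf)).trans e₂.symm, fun x y => ?_⟩
  rw [MulEquiv.trans_apply, MulEquiv.symm_apply_eq, Subtype.ext_iff]
  exact Iff.rfl

/-- The homomorphism `E → G × Aut(H)` given by the projection and the conjugation action has
kernel the center of `H`. -/
theorem PaperExt.IsExtension.ker_prod_eq {H E G : Type*} [Group H] [Group E] [Group G]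
    {ι : H →* E} {π : E →* G} (h : IsExtension ι π) (c : E →* MulAut H)
    (hc : ∀ (x : E) (a : H), ι (c x a) = x * ι a * x⁻¹) :
    (π.prod c).ker = (Subgroup.center H).map ι := by
  have hcι (z a : H) : c (ι z) a = z * a * z⁻¹ := h.inj (by simp [hc])
  ext x
  simp only [MonoidHom.mem_ker, MonoidHom.prod_apply, Prod.mk_eq_one, Subgroup.mem_map]
  constructor
  · rintro ⟨hπ, hx⟩
    obtain ⟨z, rfl⟩ : x ∈ ι.range := h.range_eq_ker ▸ hπ
    refine ⟨z, Subgroup.mem_center_iff.mpr fun a => ?_, rfl⟩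
    have hza := hcι z a
    rw [hx, MulAut.one_apply, eq_mul_inv_iff_mul_eq] at hza
    exact hza
  · rintro ⟨z, hz, rfl⟩
    refine ⟨h.pi_iota z, MulEquiv.ext fun a => ?_⟩
    rw [hcι, MulAut.one_apply, mul_inv_eq_iff_eq_mul]
    exact (Subgroup.mem_center_iff.mp hz a).symm

/-- The image of `E` in `G × Aut(H)` is the fiber product of `G` and `Aut(H)` over `Out(H)`. -/
theorem PaperExt.IsExtension.range_prod_eq {H E G : Type*} [Group H] [Group E] [Group G]
    {ι : H →* E} {π : E →* G} (h : IsExtension ι π) (c : E →* MulAut H)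
    (hc : ∀ (x : E) (a : H), ι (c x a) = x * ι a * x⁻¹)
    (κ : G →* (MulAut H ⧸ (MulAut.conj (G := H)).range))
    (hκ : ∀ x : E, κ (π x) = QuotientGroup.mk (c x)) :
    (π.prod c).range = fiberProd κ (QuotientGroup.mk' (MulAut.conj (G := H)).range) := by
  ext ⟨g, α⟩
  rw [mem_fiberProd]
  constructor
  · rintro ⟨x, hx⟩
    obtain ⟨rfl, rfl⟩ := Prod.mk.inj hx
    exact hκ x
  · intro hg
    obtain ⟨x, rfl⟩ := h.surj g
    obtain ⟨a, ha⟩ := QuotientGroup.eq.mp ((hκ x).symm.trans hg)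
    have hca : c (ι a) = MulAut.conj a := MulEquiv.ext fun b => h.inj (by simp [hc])
    refine ⟨x * ι a, Prod.ext ?_ ?_⟩
    · simp [h.pi_iota]
    · simp [hca, ha]

/-- two extensions of `G` by `H` have equal classical outer actions
`κ₁ = κ₂ : G → Out(H)` if and only if they induce the same outer action in the sense
that there is an equivalence `E₁/Z ≃ E₂/Z` of extensions of `G` by `H/Z` compatible with
the conjugation actions on `H`. -/
theorem outer_action_eq_iff_sameOuterAction
    {G H E₁ E₂ : Type*} [Group G] [Group H] [Group E₁] [Group E₂]
    (ι₁ : H →* E₁) (π₁ : E₁ →* G) (h₁ : IsExtension ι₁ π₁)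
    (ι₂ : H →* E₂) (π₂ : E₂ →* G) (h₂ : IsExtension ι₂ π₂)
    (c₁ : E₁ →* MulAut H) (hc₁ : ∀ (x : E₁) (a : H), ι₁ (c₁ x a) = x * ι₁ a * x⁻¹)
    (c₂ : E₂ →* MulAut H) (hc₂ : ∀ (x : E₂) (a : H), ι₂ (c₂ x a) = x * ι₂ a * x⁻¹)
    (κ₁ : G →* (MulAut H ⧸ (MulAut.conj (G := H)).range))
    (hκ₁ : ∀ x : E₁, κ₁ (π₁ x) = QuotientGroup.mk (c₁ x))
    (κ₂ : G →* (MulAut H ⧸ (MulAut.conj (G := H)).range))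
    (hκ₂ : ∀ x : E₂, κ₂ (π₂ x) = QuotientGroup.mk (c₂ x))
    [((Subgroup.center H).map ι₁).Normal] [((Subgroup.center H).map ι₂).Normal] :
    κ₁ = κ₂ ↔ SameOuterAction ι₁ π₁ ι₂ π₂ := by
  have conj_eq_iff (x : E₁) (y : E₂) : c₁ x = c₂ y ↔
      ∀ a b : H, (x * ι₁ a * x⁻¹ = ι₁ b ↔ y * ι₂ a * y⁻¹ = ι₂ b) := by
    simp only [← hc₁, ← hc₂, h₁.inj.eq_iff, h₂.inj.eq_iff]
    exact ⟨fun h a b => by rw [h], fun h => MulEquiv.ext fun a => ((h a _).mp rfl).symm⟩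
  constructor
  · rintro rfl
    obtain ⟨φ, hφ⟩ := exists_quotientMulEquiv_of_range_eq _ _ (h₁.ker_prod_eq c₁ hc₁)
      (h₂.ker_prod_eq c₂ hc₂)
      ((h₁.range_prod_eq c₁ hc₁ κ₁ hκ₁).trans (h₂.range_prod_eq c₂ hc₂ κ₁ hκ₂).symm)
    simp only [MonoidHom.prod_apply, Prod.mk.injEq] at hφ
    refine ⟨φ, fun a => (hφ _ _).mpr ⟨?_, ?_⟩, fun x y hxy => ((hφ x y).mp hxy).1.symm,
      fun x y hxy => (conj_eq_iff x y).mp ((hφ x y).mp hxy).2⟩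
    · rw [h₁.pi_iota, h₂.pi_iota]
    · rw [conj_eq_iff]
      intro b d
      simp only [← map_mul, ← map_inv, h₁.inj.eq_iff, h₂.inj.eq_iff]
  · rintro ⟨φ, -, hπ, hconj⟩
    ext g
    obtain ⟨x, rfl⟩ := h₁.surj g
    obtain ⟨y, hy⟩ := QuotientGroup.mk_surjective (φ (QuotientGroup.mk x))
    rw [hκ₁, (conj_eq_iff x y).mpr (hconj x y hy.symm), ← hκ₂, hπ x y hy.symm]
end

section
/- Let G, H be groups, Z the center of H, E an extension of G by H, E₀ := E/Z, and E ×_{E₀} E := {(x,y) ∈ E × E : xZ = yZ}. Then Z × {1} is a normal subgroup of E ×_{E₀} E, its intersection with the diagonal Δ(E) = {(x,x) : x ∈ E} is trivial, and (Z × {1})·Δ(E) = E ×_{E₀} E; hence E ×_{E₀} E is the internal semidirect product of Z × {1} by Δ(E), and is isomorphic to a semidirect product Z ⋊ E. -/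
open PaperExt

theorem mem_fiberProd_mk' {E : Type*} [Group E] {N : Subgroup E} [N.Normal] {p : E × E} :
    p ∈ fiberProd (QuotientGroup.mk' N) (QuotientGroup.mk' N) ↔ p.1 * p.2⁻¹ ∈ N := by
  rw [mem_fiberProd, eq_comm, ← div_eq_mul_inv]
  exact QuotientGroup.eq_iff_div_mem.trans <| by rw [← inv_mem_iff, inv_div]

/-- The fiber product of `E` with itself over `E ⧸ N` is the semidirect product of `N` by `E`
acting by conjugation: `(n, x)` corresponds to `(n * x, x)`. -/
def semidirectProductEquivFiberProd {E : Type*} [Group E] (N : Subgroup E) [N.Normal] :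
    N ⋊[MulAut.conjNormal] E ≃* ↥(fiberProd (QuotientGroup.mk' N) (QuotientGroup.mk' N)) where
  toFun a := ⟨(a.left * a.right, a.right), mem_fiberProd_mk'.mpr (by simp)⟩
  invFun p := ⟨⟨p.1.1 * p.1.2⁻¹, mem_fiberProd_mk'.mp p.2⟩, p.1.2⟩
  left_inv a := by ext <;> simp
  right_inv p := by ext <;> simp
  map_mul' a b := by ext <;> simp [mul_assoc]

theorem mem_comap_range_prod_one {A E : Type*} [Group A] [Group E] (κ : A →* E)
    {S : Subgroup (E × E)} {x : S} :
    x ∈ (κ.prod (1 : A →* E)).range.comap S.subtype ↔ x.1.1 ∈ κ.range ∧ x.1.2 = 1 := by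
  simp only [Subgroup.mem_comap, MonoidHom.mem_range, MonoidHom.prod_apply, MonoidHom.one_apply,
    Subgroup.coe_subtype, Prod.ext_iff, exists_and_right, eq_comm (a := (1 : E))]

theorem mem_comap_range_diag {E : Type*} [Group E] {S : Subgroup (E × E)} {x : S} :
    x ∈ ((MonoidHom.id E).prod (MonoidHom.id E)).range.comap S.subtype ↔ x.1.1 = x.1.2 := by
  simp only [Subgroup.mem_comap, MonoidHom.mem_range, MonoidHom.prod_apply, MonoidHom.id_apply,
    Subgroup.coe_subtype, Prod.ext_iff, exists_eq_left]

/-- for an extension `E` of `G` by `H` with `Z` the center of `H` and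
`E₀ = E/Z`, in the fiber product `E ×_{E₀} E` the subgroup `Z × {1}` is normal, meets the
diagonal `Δ(E)` trivially, and together with `Δ(E)` generates everything; hence
`E ×_{E₀} E` is the internal semidirect product of `Z × {1}` by `Δ(E)` and is isomorphic
to a semidirect product `Z ⋊ E`. -/
theorem fiberProd_over_modZ_internal_semidirect_product
    {G H E : Type*} [Group G] [Group H] [Group E]
    (ι : H →* E) (π : E →* G) (h : IsExtension ι π)
    [((Subgroup.center H).map ι).Normal] :
    let F := fiberProd (QuotientGroup.mk' ((Subgroup.center H).map ι))
      (QuotientGroup.mk' ((Subgroup.center H).map ι))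
    let Zsub := (((ι.comp (Subgroup.center H).subtype)).prod 1).range.comap F.subtype
    let ΔE := ((MonoidHom.id E).prod (MonoidHom.id E)).range.comap F.subtype
    Zsub.Normal ∧ Zsub ⊓ ΔE = ⊥ ∧ Zsub ⊔ ΔE = ⊤ ∧
      ∃ ρ : E →* MulAut (Subgroup.center H),
        Nonempty (↥F ≃* (Subgroup.center H) ⋊[ρ] E) := by
  intro F Zsub ΔE
  have hrange : (ι.comp (Subgroup.center H).subtype).range = (Subgroup.center H).map ι := by
    rw [MonoidHom.range_comp, Subgroup.range_subtype]
  have hZ (x : F) : x ∈ Zsub ↔ x.1.1 ∈ (Subgroup.center H).map ι ∧ x.1.2 = 1 := by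
    rw [← hrange]
    exact mem_comap_range_prod_one _
  have hΔ (x : F) : x ∈ ΔE ↔ x.1.1 = x.1.2 := mem_comap_range_diag
  refine ⟨⟨fun n hn g => ?_⟩, ?_, ?_, ?_⟩
  · rw [hZ] at hn ⊢
    exact ⟨Subgroup.Normal.conj_mem inferInstance _ hn.1 _, by simp [hn.2]⟩
  · refine (Subgroup.eq_bot_iff_forall _).mpr fun x hx => ?_
    have h₂ := ((hZ x).mp hx.1).2
    exact Subtype.ext (Prod.ext (((hΔ x).mp hx.2).trans h₂) h₂)
  · refine (Subgroup.eq_top_iff' _).mpr fun x => ?_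
    have hx := mem_fiberProd_mk'.mp x.2
    let d : F := ⟨(x.1.2, x.1.2), rfl⟩
    have hd : d ∈ ΔE := (hΔ d).mpr rfl
    have hxd : x * d⁻¹ ∈ Zsub := (hZ _).mpr ⟨hx, mul_inv_cancel x.1.2⟩
    rw [← inv_mul_cancel_right x d]
    exact Subgroup.mul_mem_sup hxd hd
  · exact ⟨_, ⟨(semidirectProductEquivFiberProd _).symm.trans
      (SemidirectProduct.congr' ((Subgroup.center H).equivMapOfInjective ι h.inj).symm
        (MulEquiv.refl E))⟩⟩
end

section
/- Let G, H be groups, Z the center of H, E an extension of G by H, E₀ := E/Z, and E ×_{E₀} E := {(x,y) ∈ E × E : xZ = yZ}. The diagonal Δ(H) = {(h,h) : h ∈ H} is normal in E ×_{E₀} E, and the quotient (E ×_{E₀} E)/Δ(H) — an extension of G by Z with Z embedded via z ↦ (1,z)·Δ(H) and projection (x,y)·Δ(H) ↦ x̄ ∈ G — is a split extension: it is equivalent to the semidirect product Z ⋊ G for the G-action on Z induced by conjugation in E. -/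
open PaperExt

theorem SemidirectProduct.isExtension {N G : Type*} [Group N] [Group G] (φ : G →* MulAut N) :
    IsExtension (SemidirectProduct.inl (φ := φ)) (SemidirectProduct.rightHom (φ := φ)) :=
  ⟨SemidirectProduct.inl_injective, SemidirectProduct.rightHom_surjective,
    SemidirectProduct.range_inl_eq_ker_rightHom⟩

namespace PaperExt

section ExtEquiv

variable {H E E' G : Type*} [Group H] [Group E] [Group E'] [Group G]
  {ι : H →* E} {π : E →* G} {ι' : H →* E'} {π' : E' →* G}

theorem ExtEquiv.symm (he : ExtEquiv ι π ι' π') : ExtEquiv ι' π' ι π := by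
  obtain ⟨f, hι, hπ⟩ := he
  refine ⟨f.symm, fun x => ?_, fun y => ?_⟩
  · rw [← hι, f.symm_apply_apply]
  · rw [← hπ, f.apply_symm_apply]

theorem IsExtension.of_extEquiv (h : IsExtension ι π) (he : ExtEquiv ι π ι' π') :
    IsExtension ι' π' := by
  obtain ⟨f, hι, hπ⟩ := he
  refine ⟨fun a b hab => h.inj (f.injective (by rw [hι, hι, hab])), fun g => ?_, ?_⟩
  · obtain ⟨x, rfl⟩ := h.surj g
    exact ⟨f x, hπ x⟩
  · ext y
    obtain ⟨x, rfl⟩ := f.surjective y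
    rw [MonoidHom.mem_ker, hπ, ← MonoidHom.mem_ker, ← h.range_eq_ker]
    simp only [MonoidHom.mem_range, ← hι, f.injective.eq_iff]

/-- A section transports along an equivalence of extensions. -/
theorem ExtEquiv.exists_splitting (he : ExtEquiv ι π ι' π') {s : G →* E}
    (hs : π.comp s = MonoidHom.id G) : ∃ s' : G →* E', π'.comp s' = MonoidHom.id G := by
  obtain ⟨f, -, hπ⟩ := he
  refine ⟨f.toMonoidHom.comp s, ?_⟩
  ext g
  exact (hπ (s g)).trans (DFunLike.congr_fun hs g)

end ExtEquiv

section DivHom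

variable {G H E : Type*} [Group G] [Group H] [Group E] (ι : H →* E)
  [((Subgroup.center H).map ι).Normal]

/-- The fiber product `E ×_{E/Z} E`. -/
abbrev centerFiberProd : Subgroup (E × E) :=
  fiberProd (QuotientGroup.mk' ((Subgroup.center H).map ι))
    (QuotientGroup.mk' ((Subgroup.center H).map ι))

theorem exists_center_eq_div (p : centerFiberProd ι) :
    ∃ z : Subgroup.center H, ι ↑z = (p : E × E).2 * (p : E × E).1⁻¹ := by
  have hp : (QuotientGroup.mk (p : E × E).1 : E ⧸ (Subgroup.center H).map ι) =
      QuotientGroup.mk (p : E × E).2 := p.2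
  have hm := (‹((Subgroup.center H).map ι).Normal›).mem_comm (QuotientGroup.eq.mp hp)
  obtain ⟨z, hz, e⟩ := hm
  exact ⟨⟨z, hz⟩, e⟩

/-- The homomorphism `(x, y) ↦ (y x⁻¹, π x)` from `E ×_{E/Z} E` to `Z ⋊ G`. -/
noncomputable def divHom (hι : Function.Injective ι) (π : E →* G)
    (ρ : G →* MulAut (Subgroup.center H))
    (hρ : ∀ (x : E) (z : Subgroup.center H), ι ↑(ρ (π x) z) = x * ι ↑z * x⁻¹) :
    centerFiberProd ι →* Subgroup.center H ⋊[ρ] G :=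
  MonoidHom.mk' (fun p => ⟨(exists_center_eq_div ι p).choose, π (p : E × E).1⟩) fun p q => by
    refine SemidirectProduct.ext (Subtype.ext (hι ?_)) (map_mul π _ _)
    simp only [SemidirectProduct.mul_left, Subgroup.coe_mul, map_mul, hρ]
    rw [(exists_center_eq_div ι (p * q)).choose_spec, (exists_center_eq_div ι p).choose_spec,
      (exists_center_eq_div ι q).choose_spec, Subgroup.coe_mul, Prod.fst_mul, Prod.snd_mul]
    group

variable (hι : Function.Injective ι) (π : E →* G) (ρ : G →* MulAut (Subgroup.center H))
  (hρ : ∀ (x : E) (z : Subgroup.center H), ι ↑(ρ (π x) z) = x * ι ↑z * x⁻¹)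

theorem iota_divHom_left (p : centerFiberProd ι) :
    ι ↑(divHom ι hι π ρ hρ p).left = (p : E × E).2 * (p : E × E).1⁻¹ :=
  (exists_center_eq_div ι p).choose_spec

theorem divHom_right (p : centerFiberProd ι) : (divHom ι hι π ρ hρ p).right = π (p : E × E).1 := rfl

theorem divHom_eq_iff {p : centerFiberProd ι} {w : Subgroup.center H ⋊[ρ] G} :
    divHom ι hι π ρ hρ p = w ↔
      (p : E × E).2 = ι ↑w.left * (p : E × E).1 ∧ π (p : E × E).1 = w.right := by
  rw [SemidirectProduct.ext_iff, divHom_right, Subtype.ext_iff, ← hι.eq_iff, iota_divHom_left,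
    mul_inv_eq_iff_eq_mul]

theorem divHom_surjective (hπ : Function.Surjective π) :
    Function.Surjective (divHom ι hι π ρ hρ) := by
  intro w
  obtain ⟨x, hx⟩ := hπ w.right
  have hmem := mul_mem (one_iota_mem_fiberProdZ ι w.left)
    (show (x, x) ∈ centerFiberProd ι from mem_fiberProd.mpr rfl)
  exact ⟨⟨_, hmem⟩, (divHom_eq_iff ι hι π ρ hρ).mpr ⟨by simp, by simpa using hx⟩⟩

theorem ker_divHom (h : IsExtension ι π) :
    (divHom ι h.inj π ρ hρ).ker = diagIn ι ι (centerFiberProd ι) := by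
  ext p
  have hker : π (p : E × E).1 = 1 ↔ ∃ a, ι a = (p : E × E).1 := by
    rw [← MonoidHom.mem_ker, ← h.range_eq_ker, MonoidHom.mem_range]
  rw [MonoidHom.mem_ker, divHom_eq_iff]
  simp only [SemidirectProduct.one_left, SemidirectProduct.one_right, OneMemClass.coe_one,
    map_one, one_mul, hker, diagIn, Subgroup.mem_comap, MonoidHom.mem_range,
    MonoidHom.prod_apply, Subgroup.subtype_apply, Prod.ext_iff]
  constructor
  · rintro ⟨e, a, ha⟩
    exact ⟨a, ha, ha.trans e.symm⟩
  · rintro ⟨a, ha, hb⟩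
    exact ⟨hb.symm.trans ha, a, ha⟩

end DivHom

theorem diagIn_normal {G H E : Type*} [Group G] [Group H] [Group E]
    (ι : H →* E) [((Subgroup.center H).map ι).Normal] (π : E →* G)
    (ρ : G →* MulAut (Subgroup.center H))
    (hρ : ∀ (x : E) (z : Subgroup.center H), ι ↑(ρ (π x) z) = x * ι ↑z * x⁻¹)
    (h : IsExtension ι π) : (diagIn ι ι (centerFiberProd ι)).Normal := by
  rw [← ker_divHom ι π ρ hρ h]
  infer_instance

theorem extEquiv_diagQuot_semidirectProduct {G H E : Type*} [Group G] [Group H] [Group E]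
    (ι : H →* E) [((Subgroup.center H).map ι).Normal] (π : E →* G)
    (ρ : G →* MulAut (Subgroup.center H))
    (hρ : ∀ (x : E) (z : Subgroup.center H), ι ↑(ρ (π x) z) = x * ι ↑z * x⁻¹)
    (h : IsExtension ι π) [(diagIn ι ι (centerFiberProd ι)).Normal] :
    ExtEquiv (diagQuotIota ι ι _ (one_iota_mem_fiberProdZ ι))
      (diagQuotPi ι ι (centerFiberProd ι) π h.pi_iota)
      (SemidirectProduct.inl (φ := ρ)) (SemidirectProduct.rightHom (φ := ρ)) := by
  have hker := ker_divHom ι π ρ hρ h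
  refine ⟨(QuotientGroup.quotientMulEquivOfEq hker.symm).trans
    (QuotientGroup.quotientKerEquivOfSurjective _ (divHom_surjective ι h.inj π ρ hρ h.surj)),
    fun z => ?_, fun q => ?_⟩
  · refine (divHom_eq_iff ι h.inj π ρ hρ).mpr ⟨?_, ?_⟩
    · exact (mul_one _).symm
    · exact map_one π
  · induction q using QuotientGroup.induction_on with
    | H p => rfl

end PaperExt

/-- for an extension `E` of `G` by `H`, the diagonal `Δ(H)` is normal in
`E ×_{E₀} E` (`E₀ = E/Z`), and the quotient `(E ×_{E₀} E)/Δ(H)` — an extension of `G` by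
`Z` with `Z` embedded via `z ↦ (1, z)·Δ(H)` and projection `(x, y)·Δ(H) ↦ π x` — is a
split extension, equivalent to the semidirect product `Z ⋊ G` for the `G`-action on `Z`
induced by conjugation in `E` (encoded by `ρ` and `hρ`). -/
theorem quotient_by_diagonal_is_split
    {G H E : Type*} [Group G] [Group H] [Group E]
    (ι : H →* E) (π : E →* G) (h : IsExtension ι π)
    [((Subgroup.center H).map ι).Normal]
    (ρ : G →* MulAut (Subgroup.center H))
    (hρ : ∀ (x : E) (z : Subgroup.center H), ι ↑(ρ (π x) z) = x * ι ↑z * x⁻¹) :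
    ∃ hΔ : (diagIn ι ι (fiberProd (QuotientGroup.mk' ((Subgroup.center H).map ι))
        (QuotientGroup.mk' ((Subgroup.center H).map ι)))).Normal,
      haveI := hΔ
      let qι := diagQuotIota ι ι _ (one_iota_mem_fiberProdZ ι)
      let qπ := diagQuotPi ι ι (fiberProd (QuotientGroup.mk' ((Subgroup.center H).map ι))
        (QuotientGroup.mk' ((Subgroup.center H).map ι))) π h.pi_iota
      IsExtension qι qπ ∧
      (∃ s : G →* (↥(fiberProd (QuotientGroup.mk' ((Subgroup.center H).map ι))
          (QuotientGroup.mk' ((Subgroup.center H).map ι))) ⧸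
            diagIn ι ι (fiberProd (QuotientGroup.mk' ((Subgroup.center H).map ι))
              (QuotientGroup.mk' ((Subgroup.center H).map ι)))),
        qπ.comp s = MonoidHom.id G) ∧
      ExtEquiv qι qπ (SemidirectProduct.inl (φ := ρ)) (SemidirectProduct.rightHom (φ := ρ)) := by
  have hΔ := diagIn_normal ι π ρ hρ h
  have he := extEquiv_diagQuot_semidirectProduct ι π ρ hρ h
  exact ⟨hΔ, (SemidirectProduct.isExtension ρ).of_extEquiv he.symm,
    he.symm.exists_splitting SemidirectProduct.rightHom_comp_inr, he⟩
end

section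
/- Let G, H be groups, Z the center of H, E an extension of G by H, and E₀ := E/Z. Let s : G → E₀ be a section of the projection E₀ → G, let h̄ ∈ H/Z ⊆ E₀, and define s' : G → E₀ by s'(g) = h̄·s(g)·h̄⁻¹; then s' is again a section, and the pullback extensions E_s := {(e,g) ∈ E × G : eZ = s(g)} and E_{s'} := {(e,g) ∈ E × G : eZ = s'(g)} are equivalent as extensions of G by Z. -/
open PaperExt

/-- Conjugation by an element `c` carries the pullback of `E → E/N` along `s` isomorphically
onto the pullback along the conjugate of `s` by the class of `c`. -/
def fiberProdConj {E G : Type*} [Group E] [Group G] (N : Subgroup E) [N.Normal]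
    (s s' : G →* E ⧸ N) (c : E)
    (hs' : ∀ g : G, s' g = QuotientGroup.mk c * s g * (QuotientGroup.mk c)⁻¹) :
    ↥(fiberProd (QuotientGroup.mk' N) s) ≃* ↥(fiberProd (QuotientGroup.mk' N) s') where
  toFun p := ⟨(c * p.1.1 * c⁻¹, p.1.2), by
    have hp : (QuotientGroup.mk p.1.1 : E ⧸ N) = s p.1.2 := p.2
    show (QuotientGroup.mk (c * p.1.1 * c⁻¹) : E ⧸ N) = s' p.1.2
    rw [hs', ← hp]
    rfl⟩
  invFun p := ⟨(c⁻¹ * p.1.1 * c, p.1.2), by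
    have hp : (QuotientGroup.mk p.1.1 : E ⧸ N) = s' p.1.2 := p.2
    show (QuotientGroup.mk (c⁻¹ * p.1.1 * c) : E ⧸ N) = s p.1.2
    rw [QuotientGroup.mk_mul, QuotientGroup.mk_mul, QuotientGroup.mk_inv, hp, hs']
    group⟩
  left_inv p := Subtype.ext (Prod.ext (by dsimp only; group) rfl)
  right_inv p := Subtype.ext (Prod.ext (by dsimp only; group) rfl)
  map_mul' p q := Subtype.ext (Prod.ext
    (by simp only [Subgroup.coe_mul, Prod.fst_mul]; group) rfl)

/-- for an extension `E` of `G` by `H`, a section `s : G → E₀ = E/Z`, and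
the conjugate section `s' = h̄ · s(·) · h̄⁻¹` by an element `h̄ ∈ H/Z ⊆ E₀`, the map `s'`
is again a section and the pullback extensions `E_s` and `E_{s'}` of `G` by `Z` are
equivalent. -/
theorem conjugate_sections_give_equivalent_pullbacks
    {G H E : Type*} [Group G] [Group H] [Group E]
    (ι : H →* E) (π : E →* G) (h : IsExtension ι π)
    [((Subgroup.center H).map ι).Normal]
    (s s' : G →* (E ⧸ (Subgroup.center H).map ι))
    (hs : (modPi ι π h.centerMap_le_ker).comp s = MonoidHom.id G)
    (a : H)
    (hs' : ∀ g : G, s' g = QuotientGroup.mk (ι a) * s g * (QuotientGroup.mk (ι a))⁻¹) :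
    (modPi ι π h.centerMap_le_ker).comp s' = MonoidHom.id G ∧
    ExtEquiv (pullIota ι s) (pullPi ι s) (pullIota ι s') (pullPi ι s') := by
  refine ⟨?_, fiberProdConj _ s s' (ι a) hs', ?_, fun _ => rfl⟩
  · ext g
    have hg : modPi ι π h.centerMap_le_ker (s g) = g := DFunLike.congr_fun hs g
    have ha : modPi ι π h.centerMap_le_ker (QuotientGroup.mk (ι a)) = 1 := h.pi_iota a
    simp [hs', hg, ha]
  · intro z
    refine Subtype.ext (Prod.ext ?_ rfl)
    show ι a * ι z * (ι a)⁻¹ = ι z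
    rw [← map_mul, Subgroup.mem_center_iff.mp z.2 a, map_mul, mul_inv_cancel_right]
end
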